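/- Let α < β be antichains of subsets of a finite set N, let l₀ be the size of the smallest sets in the interval poset P_{[α,β]}, set l_i = l₀ + i, and let λ_l = {X ∈ P_{[α,β]} | |X| = l}. Then every antichain χ ∈ [α,β] has a unique decomposition χ = α ∨ χ₀ ∨ χ₁ ∨ χ₂ ∨ … where for each i ∈ ℕ, χ_i ⊆ λ_{l_i} is an antichain of equal-sized sets and χ_{i+1} ⊆ χ_i⁺, where for χ ⊆ λ_l, χ⁺ = {X ∈ λ_{l+1} | X⁻ ∩ λ_l ⊆ χ}. -/

import Mathlib

/-!
Antichains of subsets of a finite universe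
(following De Causmaecker & De Wannemacker,
"On the number of antichains of sets in a finite universe").
-/

open scoped Classical

namespace Antichains

variable {V : Type*} [DecidableEq V]

/-- The `max` operator: keep only the non-dominated members of a family of sets. -/
def maxl (S : Finset (Finset V)) : Finset (Finset V) :=
  S.filter fun X => ∀ Y ∈ S, ¬X ⊂ Y

/-- `A` is an antichain of subsets: no two members are in a subset-superset relation. -/
def IsAC (A : Finset (Finset V)) : Prop :=
  ∀ X ∈ A, ∀ Y ∈ A, X ⊆ Y → X = Y

/-- The domination (partial) order on antichains: `acle A B` iff every member of `A`
is contained in some member of `B`. -/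
def acle (A B : Finset (Finset V)) : Prop :=
  ∀ X ∈ A, ∃ Y ∈ B, X ⊆ Y

/-- Strict domination. -/
def aclt (A B : Finset (Finset V)) : Prop :=
  acle A B ∧ ¬acle B A

/-- Join of antichains: `A ∨ B = max (A ∪ B)`. -/
def acjoin (A B : Finset (Finset V)) : Finset (Finset V) :=
  maxl (A ∪ B)

/-- Meet of antichains: `A ∧ B = max {X ∩ Y | X ∈ A, Y ∈ B}`. -/
def acmeet (A B : Finset (Finset V)) : Finset (Finset V) :=
  maxl ((A ×ˢ B).image fun p => p.1 ∩ p.2)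

/-- `X⁻`: the antichain of immediate subsets of `X`. -/
def im (X : Finset V) : Finset (Finset V) :=
  X.image fun x => X.erase x

/-- The interval poset `P_[a,b] = {X | a ∨ {X} ∈ (a,b]}`. -/
noncomputable def iposet [Fintype V] (a b : Finset (Finset V)) : Finset (Finset V) :=
  Finset.univ.filter fun X : Finset V => aclt a (acjoin a {X}) ∧ acle (acjoin a {X}) b

/-- `χ` belongs, as an antichain, to the interval `[a,b]`. -/
def memI (a b χ : Finset (Finset V)) : Prop :=
  IsAC χ ∧ acle a χ ∧ acle χ b

/-- `λ_l`: the sets of size `l` in the interval poset of `[a, b]`. -/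
noncomputable def lam [Fintype V] (a b : Finset (Finset V)) (l : ℕ) :
    Finset (Finset V) :=
  (iposet a b).filter fun X => X.card = l

/-- For `χ ⊆ λ_l`, the set `χ⁺ = {X ∈ λ_{l+1} | X⁻ ∩ λ_l ⊆ χ}`. -/
noncomputable def plusOp [Fintype V] (a b : Finset (Finset V)) (l : ℕ)
    (χ : Finset (Finset V)) : Finset (Finset V) :=
  (lam a b (l + 1)).filter fun X => im X ∩ lam a b l ⊆ χ

/-- The join `a ∨ χ₀ ∨ χ₁ ∨ ⋯` of `a` with all levels of a level sequence `f`. -/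
noncomputable def seqJoin [Fintype V] (a : Finset (Finset V))
    (f : ℕ → Finset (Finset V)) : Finset (Finset V) :=
  maxl (a ∪ (Finset.range (Fintype.card V + 1)).biUnion f)

theorem mem_maxl_iff {S : Finset (Finset V)} {X : Finset V} :
    X ∈ maxl S ↔ X ∈ S ∧ ∀ Y ∈ S, ¬X ⊂ Y :=
  Finset.mem_filter

/-- A family of sets dominates its members through its maximal members. -/
theorem exists_subset_mem_maxl {S : Finset (Finset V)} {X : Finset V} (hX : X ∈ S) :
    ∃ Y ∈ maxl S, X ⊆ Y := by
  obtain ⟨Y, hXY, hY⟩ := S.exists_le_maximal hX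
  exact ⟨Y, mem_maxl_iff.2 ⟨hY.prop, fun Z hZ hYZ => hYZ.2 (hY.le_of_ge hZ hYZ.1)⟩, hXY⟩

theorem mem_of_mem_maxl {S : Finset (Finset V)} {X : Finset V} (hX : X ∈ maxl S) : X ∈ S :=
  (mem_maxl_iff.1 hX).1

/-- A set lies in the interval poset iff it is dominated by `b` but not by `a`. -/
theorem mem_iposet_iff [Fintype V] {a b : Finset (Finset V)} (hab : acle a b) {X : Finset V} :
    X ∈ iposet a b ↔ (∀ A ∈ a, ¬X ⊆ A) ∧ ∃ B ∈ b, X ⊆ B := by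
  have hX : X ∈ a ∪ {X} := by simp
  obtain ⟨Z, hZ, hXZ⟩ := exists_subset_mem_maxl hX
  simp only [iposet, Finset.mem_filter, Finset.mem_univ, true_and]
  constructor
  · rintro ⟨⟨-, hna⟩, hb⟩
    refine ⟨fun A hA hXA => hna fun Y hY => ?_, ?_⟩
    · rcases Finset.mem_union.1 (mem_of_mem_maxl hY) with h | h
      · exact ⟨Y, h, subset_rfl⟩
      · exact ⟨A, hA, Finset.mem_singleton.1 h ▸ hXA⟩
    · obtain ⟨B, hB, hZB⟩ := hb Z hZ
      exact ⟨B, hB, hXZ.trans hZB⟩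
  · rintro ⟨hna, hb⟩
    refine ⟨⟨fun A hA => exists_subset_mem_maxl (Finset.mem_union_left _ hA), fun h => ?_⟩,
      fun Y hY => ?_⟩
    · obtain ⟨A, hA, hZA⟩ := h Z hZ
      exact hna A hA (hXZ.trans hZA)
    · rcases Finset.mem_union.1 (mem_of_mem_maxl hY) with h | h
      · exact hab Y h
      · exact Finset.mem_singleton.1 h ▸ hb

/-- The interval poset is order-convex. -/
theorem mem_iposet_of_subset_of_subset [Fintype V] {a b : Finset (Finset V)} (hab : acle a b)
    {X Y Z : Finset V} (hX : X ∈ iposet a b) (hZ : Z ∈ iposet a b) (hXY : X ⊆ Y) (hYZ : Y ⊆ Z) :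
    Y ∈ iposet a b := by
  rw [mem_iposet_iff hab] at *
  obtain ⟨B, hB, hZB⟩ := hZ.2
  exact ⟨fun A hA h => hX.1 A hA (hXY.trans h), B, hB, hYZ.trans hZB⟩

theorem mem_lam_iff [Fintype V] {a b : Finset (Finset V)} {l : ℕ} {X : Finset V} :
    X ∈ lam a b l ↔ X ∈ iposet a b ∧ X.card = l :=
  Finset.mem_filter

/-- The sets of size `l` in the interval poset that are dominated by `χ`. -/
noncomputable def lowerLevel [Fintype V] (a b χ : Finset (Finset V)) (l : ℕ) :
    Finset (Finset V) :=
  (lam a b l).filter fun X => ∃ Y ∈ χ, X ⊆ Y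

theorem lowerLevel_succ_subset_plusOp [Fintype V] (a b χ : Finset (Finset V)) (l : ℕ) :
    lowerLevel a b χ (l + 1) ⊆ plusOp a b l (lowerLevel a b χ l) := by
  intro X hX
  obtain ⟨hXl, Y, hY, hXY⟩ := Finset.mem_filter.1 hX
  refine Finset.mem_filter.2 ⟨hXl, fun Z hZ => ?_⟩
  obtain ⟨hZX, hZl⟩ := Finset.mem_inter.1 hZ
  obtain ⟨x, -, rfl⟩ := Finset.mem_image.1 hZX
  exact Finset.mem_filter.2 ⟨hZl, Y, hY, (X.erase_subset x).trans hXY⟩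

theorem eq_seqJoin_lowerLevel [Fintype V] {a b χ : Finset (Finset V)} {l₀ : ℕ}
    (hab : acle a b) (hl₀ : ∀ X ∈ iposet a b, l₀ ≤ X.card) (hχ : memI a b χ) :
    χ = seqJoin a fun i => lowerLevel a b χ (l₀ + i) := by
  obtain ⟨hanti, haχ, hχb⟩ := hχ
  have hdom : ∀ Y ∈ a ∪ (Finset.range (Fintype.card V + 1)).biUnion
      fun i => lowerLevel a b χ (l₀ + i), ∃ Z ∈ χ, Y ⊆ Z := by
    intro Y hY
    rcases Finset.mem_union.1 hY with h | h
    · exact haχ Y h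
    · obtain ⟨i, -, hi⟩ := Finset.mem_biUnion.1 h
      exact (Finset.mem_filter.1 hi).2
  have hmem : ∀ X ∈ χ, X ∈ a ∪ (Finset.range (Fintype.card V + 1)).biUnion
      fun i => lowerLevel a b χ (l₀ + i) := by
    intro X hX
    by_cases hXa : ∃ A ∈ a, X ⊆ A
    · obtain ⟨A, hA, hXA⟩ := hXa
      obtain ⟨Y, hY, hAY⟩ := haχ A hA
      obtain rfl := hanti X hX Y hY (hXA.trans hAY)
      exact Finset.mem_union_left _ (hXA.antisymm hAY ▸ hA)
    · push Not at hXa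
      have hXP : X ∈ iposet a b := (mem_iposet_iff hab).2 ⟨hXa, hχb X hX⟩
      have hle := hl₀ X hXP
      have hcard := X.card_le_univ
      refine Finset.mem_union_right _ (Finset.mem_biUnion.2 ⟨X.card - l₀,
        Finset.mem_range.2 (by omega), Finset.mem_filter.2
          ⟨mem_lam_iff.2 ⟨hXP, by omega⟩, X, hX, subset_rfl⟩⟩)
  ext X
  constructor
  · refine fun hX => mem_maxl_iff.2 ⟨hmem X hX, fun Y hY hXY => ?_⟩
    obtain ⟨Z, hZ, hYZ⟩ := hdom Y hY
    obtain rfl := hanti X hX Z hZ (hXY.1.trans hYZ)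
    exact hXY.2 hYZ
  · intro hX
    obtain ⟨hXS, hmax⟩ := mem_maxl_iff.1 hX
    obtain ⟨Z, hZ, hXZ⟩ := hdom X hXS
    rcases hXZ.eq_or_ssubset with rfl | h
    · exact hZ
    · exact (hmax Z (hmem Z hZ) h).elim

/-- The union of a level sequence is closed downwards within the interval poset. -/
theorem mem_of_subset_of_mem_level [Fintype V] {a b : Finset (Finset V)} {l₀ : ℕ}
    (hab : acle a b) (hl₀ : ∀ X ∈ iposet a b, l₀ ≤ X.card) {f : ℕ → Finset (Finset V)}
    (hf : ∀ i, f i ⊆ lam a b (l₀ + i)) (hplus : ∀ i, f (i + 1) ⊆ plusOp a b (l₀ + i) (f i))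
    {X : Finset V} (hX : X ∈ iposet a b) {i : ℕ} (hi : X.card = l₀ + i) (j : ℕ) :
    ∀ Y ∈ f j, X ⊆ Y → X ∈ f i := by
  induction j with
  | zero =>
    intro Y hY hXY
    have hYc := (mem_lam_iff.1 (hf 0 hY)).2
    have hXl := hl₀ X hX
    obtain rfl := Finset.eq_of_subset_of_card_le hXY (by omega)
    obtain rfl : i = 0 := by omega
    exact hY
  | succ j ih =>
    intro Y hY hXY
    obtain ⟨hYP, hYc⟩ := mem_lam_iff.1 (hf (j + 1) hY)
    rcases hXY.eq_or_ssubset with rfl | h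
    · obtain rfl : i = j + 1 := by omega
      exact hY
    · obtain ⟨y, hyY, hyX⟩ := Finset.exists_of_ssubset h
      have hXe : X ⊆ Y.erase y := Finset.subset_erase.2 ⟨hXY, hyX⟩
      refine ih (Y.erase y) ((Finset.mem_filter.1 (hplus j hY)).2 (Finset.mem_inter.2
        ⟨Finset.mem_image_of_mem _ hyY, mem_lam_iff.2 ⟨?_, ?_⟩⟩)) hXe
      · exact mem_iposet_of_subset_of_subset hab hX hYP hXe (Y.erase_subset y)
      · rw [Finset.card_erase_of_mem hyY]
        omega

/-- A level sequence is recovered from its join. -/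
theorem eq_lowerLevel_seqJoin [Fintype V] {a b : Finset (Finset V)} {l₀ : ℕ}
    (hab : acle a b) (hl₀ : ∀ X ∈ iposet a b, l₀ ≤ X.card) {f : ℕ → Finset (Finset V)}
    (hf : ∀ i, f i ⊆ lam a b (l₀ + i)) (hplus : ∀ i, f (i + 1) ⊆ plusOp a b (l₀ + i) (f i)) :
    f = fun i => lowerLevel a b (seqJoin a f) (l₀ + i) := by
  ext i X
  constructor
  · intro hX
    have hXc := (mem_lam_iff.1 (hf i hX)).2
    have hcard := X.card_le_univ
    exact Finset.mem_filter.2 ⟨hf i hX, exists_subset_mem_maxl (Finset.mem_union_right _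
      (Finset.mem_biUnion.2 ⟨i, Finset.mem_range.2 (by omega), hX⟩))⟩
  · intro hX
    obtain ⟨hXl, Z, hZ, hXZ⟩ := Finset.mem_filter.1 hX
    obtain ⟨hXP, hXc⟩ := mem_lam_iff.1 hXl
    rcases Finset.mem_union.1 (mem_of_mem_maxl hZ) with h | h
    · exact (((mem_iposet_iff hab).1 hXP).1 Z h hXZ).elim
    · obtain ⟨j, -, hj⟩ := Finset.mem_biUnion.1 h
      exact mem_of_subset_of_mem_level hab hl₀ hf hplus hXP hXc j Z hj hXZ

/-- Lemma 9 of the paper.  Let `a < b` be antichains, let `l₀` be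
the size of the smallest sets of `P_[a,b]` and `λ_l` the sets of size `l` in
`P_[a,b]`.  Every antichain `χ ∈ [a, b]` has a unique decomposition
`χ = a ∨ χ₀ ∨ χ₁ ∨ χ₂ ∨ ⋯` with `χ_i ⊆ λ_{l₀+i}` and `χ_{i+1} ⊆ χ_i⁺` for all `i`. -/
theorem statement11 {V : Type*} [DecidableEq V] [Fintype V] (a b : Finset (Finset V))
    (ha : IsAC a) (hb : IsAC b) (hab : aclt a b) (l₀ : ℕ)
    (hl₀ : (∃ X ∈ iposet a b, X.card = l₀) ∧ ∀ X ∈ iposet a b, l₀ ≤ X.card) :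
    ∀ χ : Finset (Finset V), memI a b χ →
      ∃! f : ℕ → Finset (Finset V),
        (∀ i : ℕ, f i ⊆ lam a b (l₀ + i)) ∧
        (∀ i : ℕ, f (i + 1) ⊆ plusOp a b (l₀ + i) (f i)) ∧
        χ = seqJoin a f := by
  intro χ hχ
  refine ⟨fun i => lowerLevel a b χ (l₀ + i), ⟨fun i => Finset.filter_subset _ _,
    fun i => lowerLevel_succ_subset_plusOp a b χ (l₀ + i),
    eq_seqJoin_lowerLevel hab.1 hl₀.2 hχ⟩, ?_⟩
  rintro f ⟨hf, hplus, rfl⟩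
  exact eq_lowerLevel_seqJoin hab.1 hl₀.2 hf hplus

end Antichains
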